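/- There exist a Banach space Z and a bounded linear operator T : C([0,1], ℓ₁) → Z such that T# maps C[0,1] into Π₂(ℓ₁, Z) and T# : C[0,1] → Π₂(ℓ₁, Z) is 2-summing, and yet for every N ∈ ℕ there exists an N-dimensional subspace U of C([0,1], ℓ₁) such that U is isomorphic to ℓ∞^N with isomorphism constant at most √3 and T restricted to U is an isomorphism onto its image satisfying ‖Tx‖_Z ≥ (1/√3)‖x‖ for all x ∈ U (so that T|U is equivalent to the identity operator on ℓ∞^N, with constants independent of N). In particular, T is not (2,1)-summing. One such Z is C([0,1], ℓ₁) + L₂[0,1] ⊗̂_π ℓ₂ with norm ‖x‖_Z = inf{‖x'‖_ε + ‖x''‖_π : x = x' + x''}, and one such T is the identity inclusion of C([0,1], ℓ₁) into Z. -/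

import Mathlib

set_option maxHeartbeats 1000000
set_option synthInstance.maxHeartbeats 400000

noncomputable section

open scoped BigOperators NNReal ENNReal
open NormedSpace

/-- The scalar field. -/
notation "𝕂" => ℝ
section Summing

variable {E F : Type} [NormedAddCommGroup E] [NormedSpace 𝕂 E]
  [NormedAddCommGroup F] [NormedSpace 𝕂 F]

/-- The weak ℓ_q norm of a finite family of vectors:
`sup { (Σ_i ‖e*(e_i)‖^q)^(1/q) : e* ∈ E*, ‖e*‖ ≤ 1 }`. -/
def weakNorm (q : ℝ) {n : ℕ} (e : Fin n → E) : ℝ :=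
  ⨆ f : {f : StrongDual 𝕂 E // ‖f‖ ≤ 1}, (∑ i, ‖(f : StrongDual 𝕂 E) (e i)‖ ^ q) ^ (1 / q)

/-- `T` satisfies the (p,q)-summing inequality with constant `C`:
`(Σ_i ‖T e_i‖^p)^(1/p) ≤ C · sup { (Σ_i ‖e*(e_i)‖^q)^(1/q) : ‖e*‖ ≤ 1 }`
for all finite families `e_1, …, e_n`. -/
def SummingWithC (p q C : ℝ) (T : E →L[𝕂] F) : Prop :=
  ∀ (n : ℕ) (e : Fin n → E),
    (∑ i, ‖T (e i)‖ ^ p) ^ (1 / p) ≤ C * weakNorm q e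

/-- `T` is (p,q)-summing. -/
def IsPQSumming (p q : ℝ) (T : E →L[𝕂] F) : Prop :=
  ∃ C, 0 ≤ C ∧ SummingWithC p q C T

/-- `T` is p-summing. -/
def IsPSumming (p : ℝ) (T : E →L[𝕂] F) : Prop := IsPQSumming p p T

/-- The p-summing norm `π_p(T)`: the least admissible constant. -/
def pNorm (p : ℝ) (T : E →L[𝕂] F) : ℝ :=
  sInf {C | 0 ≤ C ∧ SummingWithC p p C T}

end Summing

/-- For `f : C(Ω, 𝕂)` and a vector `y`, the function `f ⊗ y : t ↦ f(t) • y`, under the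
identification `C(Ω) ⊗̂_ε H = C(Ω, H)`. -/
def cmSmul {Ω : Type} [TopologicalSpace Ω] {H : Type} [NormedAddCommGroup H]
    [NormedSpace 𝕂 H] (f : C(Ω, 𝕂)) (y : H) : C(Ω, H) :=
  ⟨fun t => f t • y, (map_continuous f).smul continuous_const⟩

abbrev L1 : Type := ↥(lp (fun _ : ℕ => ℝ) 1)
abbrev II : Type := ↥(Set.Icc (0 : ℝ) 1)

section Weak
variable {E : Type} [NormedAddCommGroup E] [NormedSpace ℝ E]

lemma weakNorm_nonneg {q : ℝ} {n : ℕ} (e : Fin n → E) : 0 ≤ weakNorm q e :=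
  Real.iSup_nonneg fun _ => by positivity

lemma weakNorm_ge {n : ℕ} (e : Fin n → E) (f : StrongDual ℝ E) (hf : ‖f‖ ≤ 1) :
    ∑ i, (f (e i)) ^ 2 ≤ weakNorm 2 e ^ 2 := by
  have hb : BddAbove (Set.range fun f : {f : StrongDual ℝ E // ‖f‖ ≤ 1} =>
      (∑ i, ‖(f : StrongDual ℝ E) (e i)‖ ^ (2:ℝ)) ^ (1 / (2:ℝ))) := by
    refine ⟨(∑ i, ‖e i‖ ^ (2:ℝ)) ^ (1 / (2:ℝ)), ?_⟩
    rintro _ ⟨g, rfl⟩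
    dsimp only
    gcongr with i
    exact (g.1.le_opNorm _).trans (mul_le_of_le_one_left (norm_nonneg _) g.2)
  have h := le_ciSup hb ⟨f, hf⟩
  have h0 : 0 ≤ ∑ i, (f (e i)) ^ 2 := Finset.sum_nonneg fun _ _ => sq_nonneg _
  have h2 : Real.sqrt (∑ i, (f (e i)) ^ 2) ≤ weakNorm 2 e := by
    rw [Real.sqrt_eq_rpow]
    simpa [weakNorm] using h
  calc ∑ i, (f (e i)) ^ 2 = Real.sqrt (∑ i, (f (e i)) ^ 2) ^ 2 := (Real.sq_sqrt h0).symm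
    _ ≤ _ := by gcongr

end Weak

lemma exists_signs {n : ℕ} (e : Fin n → ℕ → ℝ) (M : ℕ) :
    ∃ s : ℕ → ℝ, (∀ l, |s l| ≤ 1) ∧
      ∑ l ∈ Finset.range M, ∑ i, e i l ^ 2 ≤ ∑ i, (∑ l ∈ Finset.range M, s l * e i l) ^ 2 := by
  induction M with
  | zero => exact ⟨fun _ => 0, by simp, by simp⟩
  | succ M ih =>
    obtain ⟨s, hs, h⟩ := ih
    obtain ⟨c, hc, hc2, hcp⟩ : ∃ c : ℝ, |c| ≤ 1 ∧ c ^ 2 = 1 ∧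
        0 ≤ c * ∑ i, (∑ l ∈ Finset.range M, s l * e i l) * e i M := by
      rcases le_total 0 (∑ i, (∑ l ∈ Finset.range M, s l * e i l) * e i M) with h0 | h0
      · exact ⟨1, by simp, by simp, by simpa using h0⟩
      · exact ⟨-1, by simp, by simp, by simpa using h0⟩
    refine ⟨fun l => if l = M then c else s l, fun l => ?_, ?_⟩
    · dsimp only
      split_ifs
      exacts [hc, hs l]
    · have key : ∀ i, (∑ l ∈ Finset.range (M+1), (if l = M then c else s l) * e i l) ^ 2
          = (∑ l ∈ Finset.range M, s l * e i l) ^ 2 + e i M ^ 2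
            + 2 * (c * ((∑ l ∈ Finset.range M, s l * e i l) * e i M)) := by
        intro i
        rw [Finset.sum_range_succ]
        have : ∑ l ∈ Finset.range M, (if l = M then c else s l) * e i l
            = ∑ l ∈ Finset.range M, s l * e i l := by
          refine Finset.sum_congr rfl fun l hl => ?_
          rw [if_neg (Finset.mem_range.1 hl).ne]
        rw [this, if_pos rfl]
        linear_combination (e i M ^ 2) * hc2
      simp_rw [key]
      rw [Finset.sum_add_distrib, Finset.sum_add_distrib, ← Finset.mul_sum, ← Finset.mul_sum,
        Finset.sum_range_succ]
      linarith

lemma l1_summable (y : L1) : Summable fun l => |y l| := by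
  have := (lp.memℓp y).summable (by simp)
  simpa using this

lemma l1_norm (y : L1) : ‖y‖ = ∑' l, |y l| := by
  have := lp.norm_eq_tsum_rpow (p := 1) (by simp) y
  simpa using this

lemma l1_sum_le (y : L1) (s : Finset ℕ) : ∑ l ∈ s, |y l| ≤ ‖y‖ := by
  rw [l1_norm]
  exact (l1_summable y).sum_le_tsum s fun _ _ => abs_nonneg _

lemma l1_coord (y : L1) (l : ℕ) : |y l| ≤ ‖y‖ := by
  simpa using l1_sum_le y {l}

lemma l1_summable_sq (y : L1) : Summable fun l => y l ^ 2 := by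
  refine Summable.of_nonneg_of_le (fun _ => sq_nonneg _) (fun l => ?_)
    ((l1_summable y).mul_left ‖y‖)
  rw [← sq_abs, sq]
  exact mul_le_mul_of_nonneg_right (l1_coord y l) (abs_nonneg _)

/-- The functional on `ℓ₁` given by a finitely supported sign sequence. -/
def signFun (s : ℕ → ℝ) (hs : ∀ l, |s l| ≤ 1) (M : ℕ) : StrongDual ℝ L1 :=
  LinearMap.mkContinuous
    { toFun := fun y => ∑ l ∈ Finset.range M, s l * y l
      map_add' := fun x y => by simp [mul_add, Finset.sum_add_distrib]
      map_smul' := fun c y => by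
        simp [Finset.mul_sum]
        refine Finset.sum_congr rfl fun l _ => by ring } 1 (fun y => by
        rw [one_mul]
        refine le_trans ?_ (l1_sum_le y (Finset.range M))
        change |∑ l ∈ Finset.range M, s l * y l| ≤ _
        refine (Finset.abs_sum_le_sum_abs (fun l => s l * y l) _).trans
          (Finset.sum_le_sum fun l _ => ?_)
        rw [abs_mul]
        exact mul_le_of_le_one_left (abs_nonneg _) (hs l))

lemma signFun_norm (s : ℕ → ℝ) (hs : ∀ l, |s l| ≤ 1) (M : ℕ) : ‖signFun s hs M‖ ≤ 1 :=
  LinearMap.mkContinuous_norm_le _ zero_le_one _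

lemma l1_two_summing {n : ℕ} (e : Fin n → L1) :
    ∑ i, ∑' l, (e i l) ^ 2 ≤ weakNorm 2 e ^ 2 := by
  rw [← Summable.tsum_finsetSum (fun i _ => l1_summable_sq (e i))]
  refine Real.tsum_le_of_sum_range_le (fun l => Finset.sum_nonneg fun _ _ => sq_nonneg _)
    fun M => ?_
  obtain ⟨s, hs, h⟩ := exists_signs (fun i l => e i l) M
  exact h.trans (weakNorm_ge e (signFun s hs M) (signFun_norm s hs M))

/-- The points `1/(n+1)`. -/
def pt (n : ℕ) : II := ⟨1 / ((n : ℝ) + 1), by positivity, by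
  rw [div_le_one (by positivity)]; linarith [(Nat.cast_nonneg n : (0:ℝ) ≤ n)]⟩

/-- Disjoint tent functions. -/
def bump (n : ℕ) : C(II, ℝ) :=
  ⟨fun t => max 0 (1 - 2 * ((n:ℝ) + 1) * ((n:ℝ) + 2) * |(t : ℝ) - 1 / ((n : ℝ) + 1)|), by fun_prop⟩

lemma bump_nonneg (n : ℕ) (t : II) : 0 ≤ bump n t := le_max_left _ _

lemma bump_le_one (n : ℕ) (t : II) : bump n t ≤ 1 := by
  refine max_le zero_le_one ?_
  have : 0 ≤ 2 * ((n:ℝ) + 1) * ((n:ℝ) + 2) * |(t : ℝ) - 1 / ((n : ℝ) + 1)| := by positivity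
  linarith

lemma bump_pt (n : ℕ) : bump n (pt n) = 1 := by simp [bump, pt]

lemma bump_ne {n : ℕ} {t : II} (h : bump n t ≠ 0) :
    |(t : ℝ) - 1 / ((n : ℝ) + 1)| < 1 / (2 * ((n:ℝ) + 1) * ((n:ℝ) + 2)) := by
  by_contra! h1
  apply h
  refine max_eq_left ?_
  rw [div_le_iff₀ (by positivity)] at h1
  linarith

lemma bump_disj_lt {n m : ℕ} {t : II} (hnm : n < m) (h : bump n t ≠ 0) : bump m t = 0 := by
  by_contra hm
  have h1 := bump_ne h
  have h2 := bump_ne hm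
  have hle : (n:ℝ) + 1 ≤ m := by exact_mod_cast hnm
  have h0 : (0:ℝ) ≤ n := Nat.cast_nonneg n
  have h3 : 1 / (2 * ((m:ℝ) + 1) * ((m:ℝ) + 2)) ≤ 1 / (2 * ((n:ℝ) + 1) * ((n:ℝ) + 2)) := by
    have hle' : (n:ℝ) ≤ m := by linarith
    gcongr
  have h4 : 1 / ((m:ℝ) + 1) ≤ 1 / ((n:ℝ) + 2) :=
    one_div_le_one_div_of_le (by linarith) (by linarith)
  have h5 : 1 / ((n:ℝ) + 1) - 1 / ((n:ℝ) + 2) = 2 * (1 / (2 * ((n:ℝ) + 1) * ((n:ℝ) + 2))) := by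
    field_simp
    ring
  rw [abs_lt] at h1 h2
  linarith [h1.1, h2.2]

lemma bump_disj {n m : ℕ} {t : II} (hnm : n ≠ m) (h : bump n t ≠ 0) : bump m t = 0 := by
  rcases lt_or_gt_of_ne hnm with h1 | h1
  · exact bump_disj_lt h1 h
  · by_contra h2
    exact h (bump_disj_lt h1 h2)

lemma bump_pt_ne {n m : ℕ} (h : n ≠ m) : bump m (pt n) = 0 :=
  bump_disj h (by simp [bump_pt])

lemma bump_sum (s : Finset ℕ) (t : II) : ∑ n ∈ s, bump n t ≤ 1 := by
  by_cases h : ∃ n ∈ s, bump n t ≠ 0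
  · obtain ⟨n, hn, h⟩ := h
    rw [Finset.sum_eq_single_of_mem n hn fun m _ hm => bump_disj hm.symm h]
    exact bump_le_one n t
  · push Not at h
    rw [Finset.sum_eq_zero h]
    exact zero_le_one

lemma bump_sum2 (N : ℕ) (t : II) :
    ∑ j : Fin N, ∑ l ∈ Finset.range (2 ^ (j:ℕ)), bump (Nat.pair j l) t ≤ 1 := by
  rw [Fin.sum_univ_eq_sum_range
    (fun j => ∑ l ∈ Finset.range (2 ^ j), bump (Nat.pair j l) t) N, Finset.sum_sigma']
  refine le_trans (le_of_eq ?_) (bump_sum (((Finset.range N).sigma fun j =>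
    Finset.range (2 ^ j)).image fun x => Nat.pair x.1 x.2) t)
  rw [Finset.sum_image]
  rintro ⟨a, b⟩ _ ⟨c, d⟩ _ h
  simp only [Nat.pair_eq_pair] at h
  obtain ⟨rfl, rfl⟩ := h
  rfl

/-- The values of the functionals. -/
def phi (j : ℕ) (x : C(II, L1)) : ℝ :=
  (2 ^ j : ℝ)⁻¹ * ∑ l ∈ Finset.range (2 ^ j), x (pt (Nat.pair j l)) l

lemma phi_add (j : ℕ) (x y : C(II, L1)) : phi j (x + y) = phi j x + phi j y := by
  simp [phi, Finset.sum_add_distrib, mul_add]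

lemma phi_smul (j : ℕ) (c : ℝ) (x : C(II, L1)) : phi j (c • x) = c * phi j x := by
  simp [phi, ← Finset.mul_sum]
  ring

lemma phi_le (j : ℕ) (x : C(II, L1)) : |phi j x| ≤ ‖x‖ := by
  rw [phi, abs_mul, abs_of_nonneg (by positivity), inv_mul_le_iff₀ (by positivity)]
  refine (Finset.abs_sum_le_sum_abs _ _).trans ?_
  refine (Finset.sum_le_card_nsmul _ _ ‖x‖ fun l _ =>
    (l1_coord _ l).trans (x.norm_coe_le_norm _)).trans ?_
  simp

/-- The operator. -/
def opT : C(II, L1) →L[ℝ] BoundedContinuousFunction ℕ ℝ :=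
  LinearMap.mkContinuous
    { toFun := fun x => BoundedContinuousFunction.ofNormedAddCommGroupDiscrete
        (fun j => phi j x) ‖x‖ (fun j => phi_le j x)
      map_add' := fun x y => by ext j; simp [phi_add]
      map_smul' := fun c x => by ext j; simp [phi_smul] } 1 (fun x => by
        rw [one_mul]
        exact (BoundedContinuousFunction.norm_le (norm_nonneg _)).2 fun j => phi_le j x)

lemma opT_apply (x : C(II, L1)) (j : ℕ) : opT x j = phi j x := rfl

lemma opT_norm_le (x : C(II, L1)) : ‖opT x‖ ≤ ‖x‖ :=
  (BoundedContinuousFunction.norm_le (norm_nonneg _)).2 fun j => phi_le j x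

lemma phi_le_opT (x : C(II, L1)) (j : ℕ) : |phi j x| ≤ ‖opT x‖ :=
  (opT x).norm_coe_le_norm j

lemma cmSmul_norm (f : C(II, ℝ)) (y : L1) : ‖cmSmul f y‖ ≤ ‖f‖ * ‖y‖ := by
  refine (ContinuousMap.norm_le _ (by positivity)).2 fun t => ?_
  change ‖f t • y‖ ≤ _
  rw [norm_smul]
  gcongr
  exact f.norm_coe_le_norm t

/-- `y ↦ f ⊗ y`. -/
def tens (f : C(II, ℝ)) : L1 →L[ℝ] C(II, L1) :=
  LinearMap.mkContinuous
    { toFun := fun y => cmSmul f y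
      map_add' := fun x y => by
        ext1 t
        exact smul_add (f t) x y
      map_smul' := fun c x => by
        ext1 t
        exact smul_comm (f t) c x } ‖f‖ (fun y => cmSmul_norm f y)

def opS (f : C(II, ℝ)) : L1 →L[ℝ] BoundedContinuousFunction ℕ ℝ := opT.comp (tens f)

/-- Summands of the discrete quadratic form. -/
def dd (f : C(II, ℝ)) (j : ℕ) : ℝ :=
  (4 ^ j : ℝ)⁻¹ * ∑ l ∈ Finset.range (2 ^ j), f (pt (Nat.pair j l)) ^ 2

lemma dd_nonneg (f : C(II, ℝ)) (j : ℕ) : 0 ≤ dd f j := by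
  unfold dd; positivity

lemma geo_eq (j : ℕ) : (4 ^ j : ℝ)⁻¹ * 2 ^ j = (1/2) ^ j := by
  have : (4:ℝ) ^ j = 2 ^ j * 2 ^ j := by rw [← mul_pow]; norm_num
  rw [this, one_div, inv_pow]
  field_simp

lemma dd_summable (f : C(II, ℝ)) : Summable (dd f) := by
  refine Summable.of_nonneg_of_le (dd_nonneg f) (fun j => ?_)
    (summable_geometric_two.mul_right (‖f‖ ^ 2))
  rw [← geo_eq, dd, mul_assoc]
  gcongr
  refine (Finset.sum_le_card_nsmul _ _ (‖f‖ ^ 2) fun l _ => ?_).trans (by simp)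
  rw [← sq_abs]
  gcongr
  exact f.norm_coe_le_norm _

def DD (f : C(II, ℝ)) : ℝ := ∑' j, dd f j

lemma DD_nonneg (f : C(II, ℝ)) : 0 ≤ DD f := tsum_nonneg (dd_nonneg f)

lemma phi_cm_sq (f : C(II, ℝ)) (y : L1) (j : ℕ) :
    phi j (cmSmul f y) ^ 2 ≤ DD f * ∑' l, y l ^ 2 := by
  have h1 : dd f j ≤ DD f := (dd_summable f).le_tsum j fun i _ => dd_nonneg f i
  have h2 : ∑ l ∈ Finset.range (2 ^ j), y l ^ 2 ≤ ∑' l, y l ^ 2 :=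
    (l1_summable_sq y).sum_le_tsum _ fun _ _ => sq_nonneg _
  have h3 := Finset.sum_mul_sq_le_sq_mul_sq (Finset.range (2 ^ j))
    (fun l => f (pt (Nat.pair j l))) (fun l => y l)
  have h4 : phi j (cmSmul f y) ^ 2
      = (4 ^ j : ℝ)⁻¹ * (∑ l ∈ Finset.range (2 ^ j), f (pt (Nat.pair j l)) * y l) ^ 2 := by
    have : (4:ℝ) ^ j = (2 ^ j) ^ 2 := by rw [← pow_mul, mul_comm, pow_mul]; norm_num
    rw [this, ← inv_pow, ← mul_pow]
    rfl
  rw [h4]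
  calc _ ≤ (4 ^ j : ℝ)⁻¹ * ((∑ l ∈ Finset.range (2 ^ j), f (pt (Nat.pair j l)) ^ 2) *
        ∑ l ∈ Finset.range (2 ^ j), y l ^ 2) := by gcongr
    _ = dd f j * ∑ l ∈ Finset.range (2 ^ j), y l ^ 2 := by rw [dd]; ring
    _ ≤ _ := by
      have := DD_nonneg f
      gcongr

lemma opS_sq (f : C(II, ℝ)) (y : L1) : ‖opS f y‖ ^ 2 ≤ DD f * ∑' l, y l ^ 2 := by
  have h0 : 0 ≤ DD f * ∑' l, y l ^ 2 :=
    mul_nonneg (DD_nonneg f) (tsum_nonneg fun _ => sq_nonneg _)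
  refine (Real.le_sqrt (norm_nonneg _) h0).1 ?_
  refine (BoundedContinuousFunction.norm_le (Real.sqrt_nonneg _)).2 fun j => ?_
  exact Real.abs_le_sqrt (phi_cm_sq f y j)

lemma opS_summing (f : C(II, ℝ)) : SummingWithC 2 2 (Real.sqrt (DD f)) (opS f) := by
  intro n e
  rw [← Real.sqrt_eq_rpow]
  have hw := weakNorm_nonneg (q := 2) e
  refine Real.sqrt_le_iff.2 ⟨by positivity, ?_⟩
  rw [mul_pow, Real.sq_sqrt (DD_nonneg f)]
  calc ∑ i, ‖opS f (e i)‖ ^ (2:ℝ) ≤ ∑ i, DD f * ∑' l, (e i l) ^ 2 := by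
        refine Finset.sum_le_sum fun i _ => ?_
        rw [Real.rpow_two]
        exact opS_sq f (e i)
    _ = DD f * ∑ i, ∑' l, (e i l) ^ 2 := by rw [Finset.mul_sum]
    _ ≤ _ := mul_le_mul_of_nonneg_left (l1_two_summing e) (DD_nonneg f)

lemma pNorm_opS (f : C(II, ℝ)) : pNorm 2 (opS f) ^ (2:ℝ) ≤ DD f := by
  have h0 : 0 ≤ pNorm 2 (opS f) := Real.sInf_nonneg fun _ h => h.1
  have h1 : pNorm 2 (opS f) ≤ Real.sqrt (DD f) :=
    csInf_le ⟨0, fun _ h => h.1⟩ ⟨Real.sqrt_nonneg _, opS_summing f⟩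
  rw [Real.rpow_two]
  exact (Real.le_sqrt h0 (DD_nonneg f)).1 h1

/-- Point evaluation. -/
def evl (t : II) : StrongDual ℝ C(II, ℝ) :=
  LinearMap.mkContinuous
    { toFun := fun f => f t
      map_add' := fun _ _ => rfl
      map_smul' := fun _ _ => rfl } 1 (fun f => by
        rw [one_mul]
        exact f.norm_coe_le_norm t)

lemma evl_norm (t : II) : ‖evl t‖ ≤ 1 := LinearMap.mkContinuous_norm_le _ zero_le_one _

lemma sum_DD {n : ℕ} (v : Fin n → C(II, ℝ)) : ∑ i, DD (v i) ≤ 2 * weakNorm 2 v ^ 2 := by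
  unfold DD
  have h2 : 2 * weakNorm 2 v ^ 2 = ∑' j : ℕ, (1 / 2 : ℝ) ^ j * weakNorm 2 v ^ 2 := by
    rw [tsum_mul_right, tsum_geometric_two]
  rw [← Summable.tsum_finsetSum (fun i _ => dd_summable (v i)), h2]
  refine Summable.tsum_le_tsum (fun j => ?_) (summable_sum fun i _ => dd_summable (v i))
    (summable_geometric_two.mul_right _)
  unfold dd
  rw [← Finset.mul_sum, Finset.sum_comm, ← geo_eq, mul_assoc]
  gcongr
  refine (Finset.sum_le_card_nsmul _ _ (weakNorm 2 v ^ 2) fun l _ => ?_).trans (by simp)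
  exact weakNorm_ge v (evl (pt (Nat.pair j l))) (evl_norm _)

/-- The unit vectors of `ℓ₁`. -/
def uv (l : ℕ) : L1 := lp.single 1 l (1:ℝ)

lemma uv_norm (l : ℕ) : ‖uv l‖ = 1 := by
  rw [uv, lp.norm_single (by simp)]
  simp

lemma uv_apply (l m : ℕ) : uv l m = if m = l then 1 else 0 := by
  simp [uv, Pi.single_apply]

def xx (j : ℕ) : C(II, L1) :=
  ∑ l ∈ Finset.range (2 ^ j), cmSmul (bump (Nat.pair j l)) (uv l)

lemma xx_apply (j : ℕ) (t : II) :
    xx j t = ∑ l ∈ Finset.range (2 ^ j), bump (Nat.pair j l) t • uv l := by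
  rw [xx, ContinuousMap.sum_apply]
  rfl

lemma xx_norm_apply (j : ℕ) (t : II) :
    ‖xx j t‖ ≤ ∑ l ∈ Finset.range (2 ^ j), bump (Nat.pair j l) t := by
  rw [xx_apply]
  refine (norm_sum_le _ _).trans (Finset.sum_le_sum fun l _ => ?_)
  rw [norm_smul, uv_norm, mul_one, Real.norm_eq_abs, abs_of_nonneg (bump_nonneg _ _)]

lemma xx_pt (k j l : ℕ) (hl : l < 2 ^ j) :
    xx k (pt (Nat.pair j l)) l = if k = j then 1 else 0 := by
  rw [xx_apply]
  have : ∀ m, (bump (Nat.pair k m) (pt (Nat.pair j l)) : ℝ) =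
      if k = j ∧ m = l then 1 else 0 := by
    intro m
    split_ifs with h
    · rw [h.1, h.2, bump_pt]
    · refine bump_pt_ne fun h' => h ?_
      rw [Nat.pair_eq_pair] at h'
      exact ⟨h'.1.symm, h'.2.symm⟩
  rw [lp.coeFn_sum, Finset.sum_apply]
  simp only [lp.coeFn_smul, Pi.smul_apply, uv_apply, this, smul_eq_mul]
  split_ifs with h
  · subst h
    rw [Finset.sum_eq_single_of_mem l (Finset.mem_range.2 hl)]
    · simp
    · intro m _ hm
      simp [hm]
  · simp [h]

lemma phi_xx (j k : ℕ) : phi j (xx k) = if k = j then 1 else 0 := by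
  rw [phi, Finset.sum_congr rfl fun l hl => xx_pt k j l (Finset.mem_range.1 hl)]
  split_ifs <;> simp

/-- Embedding of `ℓ∞^N`. -/
def VV (N : ℕ) : (Fin N → ℝ) →ₗ[ℝ] C(II, L1) where
  toFun a := ∑ j : Fin N, a j • xx j
  map_add' a b := by simp [add_smul, Finset.sum_add_distrib]
  map_smul' c a := by simp [mul_smul, Finset.smul_sum]

lemma VV_apply (N : ℕ) (a : Fin N → ℝ) : VV N a = ∑ j : Fin N, a j • xx j := rfl

lemma VV_norm_le (N : ℕ) (a : Fin N → ℝ) : ‖VV N a‖ ≤ ‖a‖ := by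
  refine (ContinuousMap.norm_le _ (norm_nonneg _)).2 fun t => ?_
  rw [VV_apply, ContinuousMap.sum_apply]
  refine (norm_sum_le _ _).trans ?_
  calc ∑ j : Fin N, ‖(a j • xx j) t‖
      ≤ ∑ j : Fin N, ‖a‖ * ∑ l ∈ Finset.range (2 ^ (j:ℕ)), bump (Nat.pair j l) t := by
        refine Finset.sum_le_sum fun j _ => ?_
        rw [ContinuousMap.smul_apply, norm_smul]
        exact mul_le_mul (norm_le_pi_norm a j) (xx_norm_apply j t) (norm_nonneg _) (norm_nonneg _)
    _ = ‖a‖ * ∑ j : Fin N, ∑ l ∈ Finset.range (2 ^ (j:ℕ)), bump (Nat.pair j l) t := by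
        rw [Finset.mul_sum]
    _ ≤ ‖a‖ := mul_le_of_le_one_right (norm_nonneg _) (bump_sum2 N t)

/-- `phi` as a linear map. -/
def phiL (j : ℕ) : C(II, L1) →ₗ[ℝ] ℝ where
  toFun := phi j
  map_add' := phi_add j
  map_smul' := phi_smul j

lemma phi_VV (N : ℕ) (a : Fin N → ℝ) (j : Fin N) : phi j (VV N a) = a j := by
  change phiL j (VV N a) = _
  rw [VV_apply, map_sum]
  simp only [map_smul]
  rw [Finset.sum_eq_single j]
  · change a j • phi j (xx j) = _
    simp [phi_xx]
  · intro k _ hk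
    change a k • phi j (xx k) = _
    simp [phi_xx, Fin.val_inj, hk]
  · simp

lemma VV_le_opT (N : ℕ) (a : Fin N → ℝ) : ‖a‖ ≤ ‖opT (VV N a)‖ := by
  refine (pi_norm_le_iff_of_nonneg (norm_nonneg _)).2 fun j => ?_
  rw [← phi_VV N a j]
  exact phi_le_opT _ _

lemma VV_norm (N : ℕ) (a : Fin N → ℝ) : ‖VV N a‖ = ‖a‖ :=
  le_antisymm (VV_norm_le N a) ((VV_le_opT N a).trans (opT_norm_le _))

def VI (N : ℕ) : (Fin N → ℝ) →ₗᵢ[ℝ] C(II, L1) := ⟨VV N, VV_norm N⟩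

lemma weak_one (N : ℕ) : weakNorm 1 (fun j : Fin N => xx j) ≤ 1 := by
  refine Real.iSup_le (fun f => ?_) zero_le_one
  simp only [Real.rpow_one, div_one]
  have hs : ∀ r : ℝ, ∃ c : ℝ, |c| ≤ 1 ∧ ‖r‖ = c * r := fun r => by
    rcases le_total 0 r with h | h
    · exact ⟨1, by simp, by simp [abs_of_nonneg h]⟩
    · exact ⟨-1, by simp, by simp [abs_of_nonpos h]⟩
  choose c hc hc' using fun j : Fin N => hs (f.1 (xx j))
  calc ∑ j : Fin N, ‖f.1 (xx j)‖ = f.1 (VV N c) := by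
        rw [VV_apply, map_sum]
        refine Finset.sum_congr rfl fun j _ => ?_
        rw [hc' j, map_smul, smul_eq_mul]
    _ ≤ ‖f.1 (VV N c)‖ := Real.le_norm_self _
    _ ≤ ‖f.1‖ * ‖VV N c‖ := f.1.le_opNorm _
    _ ≤ 1 * 1 := by
        refine mul_le_mul f.2 ?_ (norm_nonneg _) zero_le_one
        rw [VV_norm]
        exact (pi_norm_le_iff_of_nonneg zero_le_one).2 hc
    _ = 1 := one_mul 1

lemma not_summing : ¬ IsPQSumming 2 1 opT := by
  rintro ⟨C, hC, h⟩
  obtain ⟨N, hN⟩ := exists_nat_gt (C ^ 2)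
  have h1 := h N (fun j => xx j)
  have h2 : Real.sqrt N ≤ C := by
    refine le_trans ?_ (h1.trans (mul_le_of_le_one_right hC (weak_one N)))
    rw [Real.sqrt_eq_rpow]
    gcongr
    calc (N:ℝ) = ∑ j : Fin N, (1:ℝ) := by simp
      _ ≤ _ := by
        refine Finset.sum_le_sum fun j _ => ?_
        refine Real.one_le_rpow ?_ (by norm_num)
        have := phi_le_opT (xx j) j
        simpa [phi_xx] using this
  have h3 := (Real.sqrt_le_iff.1 h2).2
  linarith

/-- Theorem 11: there exist a Banach space `Z` and a bounded linear operator
`T : C([0,1], ℓ₁) → Z` such that `T#` maps `C[0,1]` into `Π₂(ℓ₁, Z)` and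
`T# : C[0,1] → Π₂(ℓ₁, Z)` is 2-summing, and yet for every `N ∈ ℕ` there is an `N`-dimensional
subspace `U` of `C([0,1], ℓ₁)` that is isomorphic to `ℓ∞^N` with isomorphism constant at
most `√3`, on which `T` satisfies `‖T x‖ ≥ (1/√3) ‖x‖`, so `T` restricted to `U` is
equivalent to the identity operator of `ℓ∞^N` with constants independent of `N`.
In particular `T` is not (2,1)-summing.
(In the paper, one such `Z` is `C([0,1], ℓ₁) + L₂[0,1] ⊗̂_π ℓ₂` with the norm
`‖x‖_Z = inf {‖x'‖_ε + ‖x''‖_π : x = x' + x''}`, and `T` is the identity inclusion.) -/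
theorem statement16 :
    ∃ (Z : Type) (_ : NormedAddCommGroup Z) (_ : NormedSpace ℝ Z) (_ : CompleteSpace Z)
      (T : C(Set.Icc (0 : ℝ) 1, ↥(lp (fun _ : ℕ => ℝ) 1)) →L[ℝ] Z),
      (∃ S : C(Set.Icc (0 : ℝ) 1, ℝ) → (↥(lp (fun _ : ℕ => ℝ) 1) →L[ℝ] Z),
        (∀ f y, S f y = T (cmSmul f y)) ∧
        (∀ f, IsPSumming 2 (S f)) ∧
        ∃ C, 0 ≤ C ∧ ∀ (n : ℕ) (v : Fin n → C(Set.Icc (0 : ℝ) 1, ℝ)),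
          (∑ i, pNorm 2 (S (v i)) ^ (2 : ℝ)) ^ ((1 : ℝ) / 2) ≤ C * weakNorm 2 v) ∧
      (∀ N : ℕ,
        ∃ U : Submodule ℝ C(Set.Icc (0 : ℝ) 1, ↥(lp (fun _ : ℕ => ℝ) 1)),
          Module.finrank ℝ U = N ∧
          (∃ A : U ≃L[ℝ] (Fin N → ℝ),
            @norm (U →L[ℝ] (Fin N → ℝ))
                (ContinuousLinearMap.hasOpNorm (σ₁₂ := RingHom.id ℝ) (E := U) (F := Fin N → ℝ))
                (A : U →L[ℝ] (Fin N → ℝ)) *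
              @norm ((Fin N → ℝ) →L[ℝ] U)
                (ContinuousLinearMap.hasOpNorm (σ₁₂ := RingHom.id ℝ) (E := Fin N → ℝ) (F := U))
                (A.symm : (Fin N → ℝ) →L[ℝ] U) ≤
              Real.sqrt 3) ∧
          ∀ u : U, (1 / Real.sqrt 3) * ‖(u : C(Set.Icc (0 : ℝ) 1, ↥(lp (fun _ : ℕ => ℝ) 1)))‖
            ≤ ‖T u‖) ∧
      ¬ IsPQSumming 2 1 T := by
  refine ⟨BoundedContinuousFunction ℕ ℝ, inferInstance, inferInstance, inferInstance, opT,
    ⟨opS, fun f y => rfl, fun f => ⟨_, Real.sqrt_nonneg _, opS_summing f⟩,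
      Real.sqrt 2, Real.sqrt_nonneg _, fun n v => ?_⟩, fun N => ?_, not_summing⟩
  · rw [← Real.sqrt_eq_rpow]
    have hw := weakNorm_nonneg (q := 2) v
    refine Real.sqrt_le_iff.2 ⟨by positivity, ?_⟩
    rw [mul_pow, Real.sq_sqrt (by norm_num)]
    exact (Finset.sum_le_sum fun i _ => pNorm_opS (v i)).trans (sum_DD v)
  · have h3 : (1:ℝ) ≤ Real.sqrt 3 := Real.one_le_sqrt.2 (by norm_num)
    refine ⟨LinearMap.range (VI N).toLinearMap, ?_, ?_, ?_⟩
    · rw [LinearMap.finrank_range_of_inj (VI N).injective]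
      simp
    · refine ⟨(VI N).equivRange.symm.toContinuousLinearEquiv, ?_⟩
      refine le_trans (mul_le_mul (b := 1) (d := 1) ?_ ?_
        (ContinuousLinearMap.opNorm_nonneg _) zero_le_one) (by simp)
      · refine ContinuousLinearMap.opNorm_le_bound _ zero_le_one fun x => ?_
        rw [one_mul]
        exact ((VI N).equivRange.symm.norm_map x).le
      · refine ContinuousLinearMap.opNorm_le_bound _ zero_le_one fun x => ?_
        rw [one_mul]
        exact ((VI N).equivRange.norm_map x).le
    · rintro ⟨_, a, rfl⟩
      have h1 : ‖VV N a‖ ≤ ‖opT (VV N a)‖ := (VV_norm_le N a).trans (VV_le_opT N a)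
      refine le_trans (mul_le_of_le_one_left (norm_nonneg _) ?_) h1
      rw [div_le_one (by positivity)]
      exact h3
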